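/- arXiv:1112.5018 — 3 statements merged into one kernel-verified Lean document; each statement's English description precedes it below -/
import Mathlib

section
/- Let A be a bialgebra over ℂ, let n, N ≥ 1, and let u_{ij} ∈ A (1 ≤ i,j ≤ n) be elements satisfying Δ(u_{ij}) = Σ_{k=1}^n u_{ik} ⊗ u_{kj} for all i,j. Let π : A → M_N(ℂ) be a unital algebra homomorphism, set P_{ij} = π(u_{ij}), and let φ = tr∘π where tr = Tr/N is the normalized trace on M_N(ℂ). Then for every k ≥ 1, every r ≥ 1, and all multi-indices (i_1,…,i_k), (j_1,…,j_k) ∈ {1,…,n}^k, the r-th convolution power of φ satisfies φ^{*r}(u_{i_1 j_1} ⋯ u_{i_k j_k}) = ((T_k)^r)_{(i_1…i_k),(j_1…j_k)}, where T_k is the n^k × n^k complex matrix with entries (T_k)_{(i_1…i_k),(j_1…j_k)} = tr(P_{i_1 j_1} ⋯ P_{i_k j_k}). -/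
open scoped TensorProduct

/-- Convolution of linear functionals on a coalgebra over `ℂ`:
`φ * ψ := (φ ⊗ ψ) ∘ Δ`, using the identification `ℂ ⊗ ℂ ≅ ℂ`. -/
noncomputable def conv {A : Type*} [AddCommMonoid A] [Module ℂ A] [Coalgebra ℂ A]
    (φ ψ : A →ₗ[ℂ] ℂ) : A →ₗ[ℂ] ℂ :=
  (TensorProduct.lid ℂ ℂ).toLinearMap ∘ₗ TensorProduct.map φ ψ ∘ₗ Coalgebra.comul

/-- Convolution powers: `convPow φ 1 = φ` and `convPow φ (r+1) = conv φ (convPow φ r)`.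
The value at `0` is junk (the zero functional). -/
noncomputable def convPow {A : Type*} [AddCommMonoid A] [Module ℂ A] [Coalgebra ℂ A]
    (φ : A →ₗ[ℂ] ℂ) : ℕ → (A →ₗ[ℂ] ℂ)
  | 0 => 0
  | 1 => φ
  | (r + 2) => conv φ (convPow φ (r + 1))

theorem comul_prod_ofFn_of_comul_eq_sum {R A ι : Type*} [CommSemiring R] [Semiring A]
    [Bialgebra R A] [Fintype ι] (u : ι → ι → A)
    (hu : ∀ i j, Coalgebra.comul (R := R) (u i j) = ∑ s, u i s ⊗ₜ[R] u s j) :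
    ∀ {k : ℕ} (i j : Fin k → ι),
      Coalgebra.comul (R := R) (List.ofFn fun l => u (i l) (j l)).prod =
        ∑ s : Fin k → ι,
          (List.ofFn fun l => u (i l) (s l)).prod ⊗ₜ[R] (List.ofFn fun l => u (s l) (j l)).prod
  | 0, i, j => by simp [Algebra.TensorProduct.one_def]
  | k + 1, i, j => by
    rw [← (Fin.consEquiv fun _ => ι).sum_comp, Fintype.sum_prod_type]
    simp only [List.ofFn_succ, List.prod_cons, Bialgebra.comul_mul, hu, Fin.consEquiv_apply,
      Fin.cons_zero, Fin.cons_succ,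
      comul_prod_ofFn_of_comul_eq_sum u hu (fun l => i l.succ) fun l => j l.succ,
      Finset.sum_mul_sum, Algebra.TensorProduct.tmul_mul_tmul]

theorem conv_eq_sum_of_comul_eq_sum {A ι : Type*} [AddCommMonoid A] [Module ℂ A] [Coalgebra ℂ A]
    (φ ψ : A →ₗ[ℂ] ℂ) {a : A} {s : Finset ι} {x y : ι → A}
    (ha : Coalgebra.comul (R := ℂ) a = ∑ m ∈ s, x m ⊗ₜ[ℂ] y m) :
    conv φ ψ a = ∑ m ∈ s, φ (x m) * ψ (y m) := by
  simp [conv, ha]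

/-- Convolution powers evaluated on a comatrix are matrix powers. -/
theorem convPow_succ_eq_pow_of_comul_eq_sum {A ι : Type*} [AddCommMonoid A] [Module ℂ A]
    [Coalgebra ℂ A] [Fintype ι] [DecidableEq ι] (φ : A →ₗ[ℂ] ℂ) (v : ι → ι → A)
    (hv : ∀ i j, Coalgebra.comul (R := ℂ) (v i j) = ∑ s, v i s ⊗ₜ[ℂ] v s j) (r : ℕ) (i j : ι) :
    convPow φ (r + 1) (v i j) = ((Matrix.of fun i j => φ (v i j)) ^ (r + 1)) i j := by
  induction r generalizing i with
  | zero => simp [convPow]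
  | succ r ih =>
    rw [convPow, conv_eq_sum_of_comul_eq_sum _ _ (hv i j), pow_succ', Matrix.mul_apply]
    simp [ih]


theorem stmt0 {A : Type*} [Ring A] [Bialgebra ℂ A]
    (n N : ℕ) (hn : 1 ≤ n) (hN : 1 ≤ N)
    (u : Fin n → Fin n → A)
    (hu : ∀ i j, Coalgebra.comul (R := ℂ) (u i j) = ∑ s : Fin n, u i s ⊗ₜ[ℂ] u s j)
    (π : A →ₐ[ℂ] Matrix (Fin N) (Fin N) ℂ)
    (P : Fin n → Fin n → Matrix (Fin N) (Fin N) ℂ)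
    (hP : ∀ i j, P i j = π (u i j))
    (φ : A →ₗ[ℂ] ℂ)
    (hφ : ∀ a : A, φ a = (π a).trace / N)
    (k : ℕ) (hk : 1 ≤ k)
    (T : Matrix (Fin k → Fin n) (Fin k → Fin n) ℂ)
    (hT : ∀ i j : Fin k → Fin n,
      T i j = (((List.finRange k).map (fun l => P (i l) (j l))).prod).trace / N)
    (r : ℕ) (hr : 1 ≤ r) (i j : Fin k → Fin n) :
    convPow φ r (((List.finRange k).map (fun l => u (i l) (j l))).prod) = (T ^ r) i j := by
  obtain ⟨r, rfl⟩ := Nat.exists_eq_add_of_le' hr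
  have hTφ : T = Matrix.of fun i j => φ (List.ofFn fun l => u (i l) (j l)).prod := by
    ext i j
    simp [hT, hφ, hP, map_list_prod, List.map_ofFn, ← List.ofFn_eq_map, Function.comp_def]
  rw [hTφ, ← List.ofFn_eq_map]
  exact convPow_succ_eq_pow_of_comul_eq_sum φ
    (fun i j : Fin k → Fin n => (List.ofFn fun l => u (i l) (j l)).prod)
    (comul_prod_ofFn_of_comul_eq_sum u hu) r i j
end

section
/- Let A be a bialgebra over ℂ and let φ : A → ℂ be a linear functional. Assume that for every a ∈ A the sequence (φ^{*k}(a))_{k≥1} of values of the convolution powers is bounded, and that for every a ∈ A the Cesàro limit φ̃(a) := lim_{N→∞} (1/N) Σ_{k=1}^N φ^{*k}(a) exists. Then the resulting linear functional φ̃ satisfies φ * φ̃ = φ̃ = φ̃ * φ and φ̃ * φ̃ = φ̃; in particular φ̃ is idempotent with respect to convolution. -/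
open scoped TensorProduct

section Convolution

variable {A : Type*} [AddCommMonoid A] [Module ℂ A] [Coalgebra ℂ A]

theorem conv_apply_repr (φ ψ : A →ₗ[ℂ] ℂ) {a : A} {ι : Type*}
    (R : Coalgebra.Repr ℂ a ι) :
    conv φ ψ a = ∑ i ∈ R.index, φ (R.left i) * ψ (R.right i) := by
  simp [conv, ← R.eq, map_sum]

theorem conv_eq_ofConv_mul (φ ψ : A →ₗ[ℂ] ℂ) :
    conv φ ψ = (WithConv.toConv φ * WithConv.toConv ψ).ofConv := by
  ext a
  rw [conv_apply_repr φ ψ (Coalgebra.Repr.arbitrary ℂ a)]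
  exact ((Coalgebra.Repr.arbitrary ℂ a).convMul_apply _ _).symm

theorem conv_assoc (φ ψ χ : A →ₗ[ℂ] ℂ) : conv (conv φ ψ) χ = conv φ (conv ψ χ) := by
  simp [conv_eq_ofConv_mul, mul_assoc]

theorem convPow_succ (φ : A →ₗ[ℂ] ℂ) {r : ℕ} (hr : 1 ≤ r) :
    convPow φ (r + 1) = conv φ (convPow φ r) := by
  obtain ⟨k, rfl⟩ := Nat.exists_eq_add_of_le' hr
  rfl

theorem conv_convPow_comm (φ : A →ₗ[ℂ] ℂ) {r : ℕ} (hr : 1 ≤ r) :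
    conv (convPow φ r) φ = convPow φ (r + 1) := by
  induction r, hr using Nat.le_induction with
  | base => rfl
  | succ r hr ih => rw [convPow_succ φ hr, conv_assoc, ih, ← convPow_succ φ (by omega)]

theorem conv_convPow_eq_of_conv_eq {φ ψ : A →ₗ[ℂ] ℂ} (h : conv φ ψ = ψ) {r : ℕ} (hr : 1 ≤ r) :
    conv (convPow φ r) ψ = ψ := by
  induction r, hr using Nat.le_induction with
  | base => exact h
  | succ r hr ih => rw [convPow_succ φ hr, conv_assoc, ih, h]

theorem tendsto_conv_cesaro_left (ψ : A →ₗ[ℂ] ℂ) {u : ℕ → A →ₗ[ℂ] ℂ} {v : A →ₗ[ℂ] ℂ}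
    (h : ∀ a, Filter.Tendsto (fun M : ℕ => (M : ℂ)⁻¹ * ∑ r ∈ Finset.Icc 1 M, u r a)
      Filter.atTop (nhds (v a))) (a : A) :
    Filter.Tendsto (fun M : ℕ => (M : ℂ)⁻¹ * ∑ r ∈ Finset.Icc 1 M, conv (u r) ψ a)
      Filter.atTop (nhds (conv v ψ a)) := by
  have R := Coalgebra.Repr.arbitrary ℂ a
  simp only [conv_apply_repr _ _ R]
  refine (tendsto_finsetSum R.index fun i _ =>
    (h (R.left i)).mul_const (ψ (R.right i))).congr fun M => ?_
  rw [Finset.sum_comm, Finset.mul_sum]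
  simp only [mul_assoc, Finset.sum_mul]

theorem tendsto_conv_cesaro_right (ψ : A →ₗ[ℂ] ℂ) {u : ℕ → A →ₗ[ℂ] ℂ} {v : A →ₗ[ℂ] ℂ}
    (h : ∀ a, Filter.Tendsto (fun M : ℕ => (M : ℂ)⁻¹ * ∑ r ∈ Finset.Icc 1 M, u r a)
      Filter.atTop (nhds (v a))) (a : A) :
    Filter.Tendsto (fun M : ℕ => (M : ℂ)⁻¹ * ∑ r ∈ Finset.Icc 1 M, conv ψ (u r) a)
      Filter.atTop (nhds (conv ψ v a)) := by
  have R := Coalgebra.Repr.arbitrary ℂ a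
  simp only [conv_apply_repr _ _ R]
  refine (tendsto_finsetSum R.index fun i _ =>
    (h (R.right i)).const_mul (ψ (R.left i))).congr fun M => ?_
  rw [Finset.sum_comm, Finset.mul_sum]
  simp only [Finset.mul_sum, mul_left_comm]

end Convolution

/-- Shifting a bounded sequence by one does not change its Cesàro limit. -/
theorem tendsto_cesaro_shift {x : ℕ → ℂ} {C : ℝ} {l : ℂ} (hx : ∀ r, 1 ≤ r → ‖x r‖ ≤ C)
    (h : Filter.Tendsto (fun M : ℕ => (M : ℂ)⁻¹ * ∑ r ∈ Finset.Icc 1 M, x r)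
      Filter.atTop (nhds l)) :
    Filter.Tendsto (fun M : ℕ => (M : ℂ)⁻¹ * ∑ r ∈ Finset.Icc 1 M, x (r + 1))
      Filter.atTop (nhds l) := by
  have hinv : Filter.Tendsto (fun M : ℕ => (M : ℂ)⁻¹) Filter.atTop (nhds 0) :=
    tendsto_inv_atTop_nhds_zero_nat
  have hdiff : Filter.Tendsto (fun M : ℕ => (M : ℂ)⁻¹ * (x (M + 1) - x 1))
      Filter.atTop (nhds 0) := by
    refine hinv.zero_mul_isBoundedUnder_le
      (Filter.isBoundedUnder_of ⟨C + C, fun M => ?_⟩)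
    exact (norm_sub_le _ _).trans (add_le_add (hx _ (by omega)) (hx _ le_rfl))
  have hsum (M : ℕ) : ∑ r ∈ Finset.Icc 1 M, x (r + 1)
      = ∑ r ∈ Finset.Icc 1 M, x r + (x (M + 1) - x 1) := by
    induction M with
    | zero => simp
    | succ M ih =>
      rw [Finset.sum_Icc_succ_top (by omega), Finset.sum_Icc_succ_top (by omega), ih]
      ring
  simpa only [hsum, mul_add, add_zero] using h.add hdiff

/-- The Cesàro limit of the convolution powers of a functional on a coalgebra absorbs the functional
on both sides and is idempotent. -/
theorem conv_cesaro_limit {A : Type*} [AddCommMonoid A] [Module ℂ A] [Coalgebra ℂ A]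
    (φ : A →ₗ[ℂ] ℂ)
    (hbound : ∀ a : A, ∃ C : ℝ, ∀ r : ℕ, 1 ≤ r → ‖convPow φ r a‖ ≤ C)
    (φt : A →ₗ[ℂ] ℂ)
    (hlim : ∀ a : A,
      Filter.Tendsto (fun M : ℕ => (M : ℂ)⁻¹ * ∑ r ∈ Finset.Icc 1 M, convPow φ r a)
        Filter.atTop (nhds (φt a))) :
    conv φ φt = φt ∧ conv φt φ = φt ∧ conv φt φt = φt := by
  have hshift (a : A) : Filter.Tendsto
      (fun M : ℕ => (M : ℂ)⁻¹ * ∑ r ∈ Finset.Icc 1 M, convPow φ (r + 1) a)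
      Filter.atTop (nhds (φt a)) := by
    obtain ⟨C, hC⟩ := hbound a
    exact tendsto_cesaro_shift (x := fun r => convPow φ r a) hC (hlim a)
  have hleft : conv φ φt = φt := by
    refine LinearMap.ext fun a => ?_
    refine tendsto_nhds_unique (tendsto_conv_cesaro_right φ hlim a)
      ((hshift a).congr fun M => ?_)
    congr 1
    exact Finset.sum_congr rfl fun r hr => by rw [convPow_succ φ (Finset.mem_Icc.1 hr).1]
  refine ⟨hleft, ?_, ?_⟩
  · refine LinearMap.ext fun a => ?_
    refine tendsto_nhds_unique (tendsto_conv_cesaro_left φ hlim a)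
      ((hshift a).congr fun M => ?_)
    congr 1
    exact Finset.sum_congr rfl fun r hr => by rw [conv_convPow_comm φ (Finset.mem_Icc.1 hr).1]
  · refine LinearMap.ext fun a => ?_
    refine tendsto_nhds_unique (tendsto_conv_cesaro_left φt hlim a)
      (tendsto_const_nhds.congr' ?_)
    filter_upwards [Filter.eventually_ge_atTop 1] with M hM
    have hM0 : (M : ℂ) ≠ 0 := by exact_mod_cast (by omega : M ≠ 0)
    rw [Finset.sum_congr rfl fun r hr => by
      rw [conv_convPow_eq_of_conv_eq hleft (Finset.mem_Icc.1 hr).1]]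
    simp [hM0]

theorem stmt4 {A : Type*} [Ring A] [Bialgebra ℂ A]
    (φ : A →ₗ[ℂ] ℂ)
    (hbound : ∀ a : A, ∃ C : ℝ, ∀ r : ℕ, 1 ≤ r → ‖convPow φ r a‖ ≤ C)
    (φt : A →ₗ[ℂ] ℂ)
    (hlim : ∀ a : A,
      Filter.Tendsto (fun M : ℕ => (M : ℂ)⁻¹ * ∑ r ∈ Finset.Icc 1 M, convPow φ r a)
        Filter.atTop (nhds (φt a))) :
    conv φ φt = φt ∧ conv φt φ = φt ∧ conv φt φt = φt :=
  conv_cesaro_limit φ hbound φt hlim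
end

section
/- Every linear functional ψ : M_n(ℂ) → ℂ can be written as a linear combination of four positive linear functionals; more precisely, there exist positive linear functionals ψ₁, ψ₂, ψ₃, ψ₄ on M_n(ℂ) such that ψ = ψ₁ − ψ₂ + i·ψ₃ − i·ψ₄. -/
open scoped ComplexOrder

open scoped MatrixOrder in
/-- Every complex matrix is a linear combination of four positive semidefinite matrices. -/
theorem Matrix.exists_posSemidef_linear_combination {m : Type*} [Fintype m] [DecidableEq m]
    (A : Matrix m m ℂ) :
    ∃ A₁ A₂ A₃ A₄ : Matrix m m ℂ, A₁.PosSemidef ∧ A₂.PosSemidef ∧ A₃.PosSemidef ∧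
      A₄.PosSemidef ∧ A = A₁ - A₂ + Complex.I • A₃ - Complex.I • A₄ := by
  have hpos (C : Matrix m m ℂ) : (C⁺).PosSemidef :=
    Matrix.nonneg_iff_posSemidef.mp (CFC.posPart_nonneg C)
  have hneg (C : Matrix m m ℂ) : (C⁻).PosSemidef :=
    Matrix.nonneg_iff_posSemidef.mp (CFC.negPart_nonneg C)
  refine ⟨_, _, _, _, hpos _, hneg _, hpos _, hneg _,
    (CStarAlgebra.linear_combination_nonneg A).symm.trans (add_sub_assoc _ _ _).symm⟩

open scoped MatrixOrder in
/-- The trace of a product of two positive semidefinite matrices is nonnegative. -/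
theorem Matrix.PosSemidef.trace_mul_nonneg {m : Type*} [Fintype m]
    {A B : Matrix m m ℂ} (hA : A.PosSemidef) (hB : B.PosSemidef) : 0 ≤ (A * B).trace := by
  classical
  obtain ⟨X, rfl⟩ := CStarAlgebra.nonneg_iff_eq_star_mul_self.mp hA.nonneg
  rw [Matrix.trace_mul_cycle, Matrix.trace_mul_comm, ← Matrix.mul_assoc]
  exact (hB.mul_mul_conjTranspose_same X).trace_nonneg

/-- Every linear functional on square matrices is of the form `B ↦ trace (A * B)`. -/
theorem Matrix.exists_eq_traceLinearMap_comp_mulLeft {m R : Type*} [Fintype m] [DecidableEq m]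
    [CommSemiring R] (ψ : Matrix m m R →ₗ[R] R) :
    ∃ A : Matrix m m R, ψ = Matrix.traceLinearMap m R R ∘ₗ LinearMap.mulLeft R A := by
  refine ⟨Matrix.of fun i j => ψ (Matrix.single j i 1), ?_⟩
  refine Matrix.ext_linearMap R fun i j => ?_
  ext
  simp [Matrix.trace_mul_single]

theorem stmt12 (n : ℕ) (ψ : Matrix (Fin n) (Fin n) ℂ →ₗ[ℂ] ℂ) :
    ∃ ψ₁ ψ₂ ψ₃ ψ₄ : Matrix (Fin n) (Fin n) ℂ →ₗ[ℂ] ℂ,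
      (∀ B : Matrix (Fin n) (Fin n) ℂ, B.PosSemidef → 0 ≤ ψ₁ B) ∧
      (∀ B : Matrix (Fin n) (Fin n) ℂ, B.PosSemidef → 0 ≤ ψ₂ B) ∧
      (∀ B : Matrix (Fin n) (Fin n) ℂ, B.PosSemidef → 0 ≤ ψ₃ B) ∧
      (∀ B : Matrix (Fin n) (Fin n) ℂ, B.PosSemidef → 0 ≤ ψ₄ B) ∧
      ψ = ψ₁ - ψ₂ + Complex.I • ψ₃ - Complex.I • ψ₄ := by
  obtain ⟨A, rfl⟩ := Matrix.exists_eq_traceLinearMap_comp_mulLeft ψ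
  obtain ⟨A₁, A₂, A₃, A₄, h₁, h₂, h₃, h₄, rfl⟩ := Matrix.exists_posSemidef_linear_combination A
  let φ (C : Matrix (Fin n) (Fin n) ℂ) :=
    Matrix.traceLinearMap (Fin n) ℂ ℂ ∘ₗ LinearMap.mulLeft ℂ C
  refine ⟨φ A₁, φ A₂, φ A₃, φ A₄, fun _ => h₁.trace_mul_nonneg, fun _ => h₂.trace_mul_nonneg,
    fun _ => h₃.trace_mul_nonneg, fun _ => h₄.trace_mul_nonneg, LinearMap.ext fun B => ?_⟩
  simp [φ, sub_mul, add_mul]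
end
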